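/- Let S be a semigroup, σ: S → S an involutive automorphism, and let f, g, h: S → ℂ satisfy f(xσ(y)) = f(x)g(y) + g(x)f(y) + h(x)h(y) for all x, y ∈ S, with f^e and h^e linearly independent. Suppose g^e = αf^e + βh^e for some constants α, β ∈ ℂ. Then g^o(xy) = −αf^o(xy) and h^o(xy) = −βf^o(xy) for all x, y ∈ S. -/

import Mathlib

/-- The even part of a function with respect to an involution `σ`. -/
noncomputable def evenPart {S : Type*} (σ : S → S) (f : S → ℂ) : S → ℂ :=
  fun x => (f x + f (σ x)) / 2

/-- The odd part of a function with respect to an involution `σ`. -/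
noncomputable def oddPart {S : Type*} (σ : S → S) (f : S → ℂ) : S → ℂ :=
  fun x => (f x - f (σ x)) / 2

/-- The symmetry of the right-hand side of the equation forces `f (x * y) = f (σ (y * x))`. -/
theorem apply_mul_eq_apply_involution_mul_swap {S : Type*} [Semigroup S] {σ : S → S}
    (hσmul : ∀ x y : S, σ (x * y) = σ x * σ y) (hσinv : ∀ x : S, σ (σ x) = x) {f : S → ℂ}
    (hsymm : ∀ x y : S, f (x * σ y) = f (y * σ x)) (x y : S) :
    f (x * y) = f (σ (y * x)) := by
  simpa only [hσmul, hσinv] using hsymm x (σ y)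

theorem apply_involution_mul_mul {S : Type*} [Semigroup S] {σ : S → S}
    (hσmul : ∀ x y : S, σ (x * y) = σ x * σ y) (hσinv : ∀ x : S, σ (σ x) = x) {f : S → ℂ}
    (hsymm : ∀ x y : S, f (x * σ y) = f (y * σ x)) (x y z : S) :
    f (σ (x * (y * z))) = f (x * (y * z)) := by
  have hswap := apply_mul_eq_apply_involution_mul_swap hσmul hσinv hsymm
  calc
    f (σ (x * (y * z))) = f (z * (x * y)) := by rw [hswap, mul_assoc]
    _ = f (σ (y * (z * x))) := by rw [← mul_assoc, hswap]
    _ = f (x * (y * z)) := by rw [hswap x, mul_assoc]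

theorem oddParts_on_products {S : Type*} [Semigroup S] (σ : S → S)
    (hσmul : ∀ x y : S, σ (x * y) = σ x * σ y) (hσinv : ∀ x : S, σ (σ x) = x)
    (f g h : S → ℂ)
    (hfgh : ∀ x y : S, f (x * σ y) = f x * g y + g x * f y + h x * h y)
    (hindep : LinearIndependent ℂ ![evenPart σ f, evenPart σ h])
    (α β : ℂ)
    (hge : ∀ x : S, evenPart σ g x = α * evenPart σ f x + β * evenPart σ h x) :
    ∀ x y : S, oddPart σ g (x * y) = -α * oddPart σ f (x * y) ∧
      oddPart σ h (x * y) = -β * oddPart σ f (x * y) := by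
  intro x y
  have hsymm : ∀ x y : S, f (x * σ y) = f (y * σ x) := fun x y => by
    rw [hfgh, hfgh]; ring
  have hzero : ∀ t : S,
      (oddPart σ g (x * y) + α * oddPart σ f (x * y)) * evenPart σ f t +
        (oddPart σ h (x * y) + β * oddPart σ f (x * y)) * evenPart σ h t = 0 := by
    intro t
    have h₁ := hfgh t (x * y)
    have h₂ := hfgh (σ t) (x * y)
    have h₃ := hfgh t (σ (x * y))
    have h₄ := hfgh (σ t) (σ (x * y))
    have e₁ := apply_involution_mul_mul hσmul hσinv hsymm t (σ x) (σ y)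
    have e₂ := apply_involution_mul_mul hσmul hσinv hsymm (σ t) (σ x) (σ y)
    have k := hge t
    simp only [hσmul, hσinv, evenPart, oddPart] at h₁ h₂ h₃ h₄ e₁ e₂ k ⊢
    linear_combination (h₄ - h₁ - e₁ + h₃ - h₂ - e₂) / 4 - k * (f (x * y) - f (σ x * σ y)) / 2
  obtain ⟨hg, hh⟩ := LinearIndependent.pair_iff.mp hindep _ _ (funext hzero)
  exact ⟨by linear_combination hg, by linear_combination hh⟩
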